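/- Let A be a unital alternative *-algebra over ℂ containing a nontrivial symmetric idempotent e satisfying conditions (♠) and (♣), and let Φ : A → A be a map satisfying the *-Jordan n-derivation identity in the last two slots. Then, with e₁ = e and e₂ = 1 − e, one has Φ(e_i) = e₁(Φ(e_i)e₂) + e₂(Φ(e_i)e₁) for i = 1, 2, and Φ(1) = 0. -/

import Mathlib

/-- The Jordan `•`-product `a • b = ab + b a*`. -/
def starJordan {A : Type*} [NonAssocRing A] [StarRing A] (a b : A) : A :=
  a * b + b * star a

/-- Left-normed iterated Jordan `•`-product of a list (empty list ↦ 0, junk value). -/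
def leftStarJordan {A : Type*} [NonAssocRing A] [StarRing A] : List A → A
  | [] => 0
  | x :: xs => xs.foldl starJordan x

/-- The family `a₁ = ⋯ = a_{n-2} = 1`, `a_{n-1} = x`, `a_n = y`. -/
def lastTwoFamily {A : Type*} [One A] (n : ℕ) (x y : A) : Fin n → A :=
  fun i => if (i : ℕ) = n - 2 then x else if (i : ℕ) = n - 1 then y else 1

/-- `e₁ = e`, `e₂ = 1 - e`. -/
def peirceIdem {A : Type*} [NonAssocRing A] (e : A) : Fin 2 → A :=
  fun i => if i = 0 then e else 1 - e

/-- Membership in the Peirce component `A_{ij}`: `eᵢ x = x` and `x eⱼ = x`. -/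
def inPeirce {A : Type*} [NonAssocRing A] (e : A) (i j : Fin 2) (x : A) : Prop :=
  peirceIdem e i * x = x ∧ x * peirceIdem e j = x

/-- The inner derivation `Ξ_{y,z}(a) = y(za) − z(ya) + y(az) − (ya)z + (az)y − (ay)z`. -/
def innerDer {A : Type*} [NonAssocRing A] (y z a : A) : A :=
  y * (z * a) - z * (y * a) + y * (a * z) - (y * a) * z + (a * z) * y - (a * y) * z

section Alternative

variable {A : Type*} [NonAssocRing A]

/-- Expanded form of the skew-symmetry of the associator in its first two arguments. -/
theorem alternative_left_polarized (halt₁ : ∀ a b : A, a * a * b = a * (a * b)) (a b x : A) :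
    a * b * x + b * a * x = a * (b * x) + b * (a * x) := by
  have h := halt₁ (a + b) x
  simp only [add_mul, mul_add, halt₁] at h
  have h' : a * b * x + b * a * x - (a * (b * x) + b * (a * x)) = 0 := by
    rw [← sub_eq_zero] at h
    rw [← h]; abel
  exact sub_eq_zero.mp h'

/-- Expanded form of the skew-symmetry of the associator in its last two arguments. -/
theorem alternative_right_polarized (halt₂ : ∀ a b : A, b * a * a = b * (a * a)) (x a b : A) :
    x * a * b + x * b * a = x * (a * b) + x * (b * a) := by
  have h := halt₂ (a + b) x
  simp only [add_mul, mul_add, halt₂] at h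
  have h' : x * a * b + x * b * a - (x * (a * b) + x * (b * a)) = 0 := by
    rw [← sub_eq_zero] at h
    rw [← h]; abel
  exact sub_eq_zero.mp h'

theorem alternative_flexible (halt₁ : ∀ a b : A, a * a * b = a * (a * b))
    (halt₂ : ∀ a b : A, b * a * a = b * (a * a)) (a b : A) : a * b * a = a * (b * a) := by
  have h := alternative_left_polarized halt₁ a b a
  rw [halt₂ a b, add_left_inj] at h
  exact h

theorem idem_mul_idem_mul (halt₁ : ∀ a b : A, a * a * b = a * (a * b)) {e : A}
    (heIdem : e * e = e) (x : A) : e * (e * x) = e * x := by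
  rw [← halt₁, heIdem]

theorem mul_idem_mul_idem (halt₂ : ∀ a b : A, b * a * a = b * (a * a)) {e : A}
    (heIdem : e * e = e) (x : A) : x * e * e = x * e := by
  rw [halt₂, heIdem]

/-- An element of the Peirce corner `A₁₁` vanishes as soon as it annihilates `A₁₂` from the left,
provided `1 - e` satisfies the faithfulness condition `hcl`. -/
theorem eq_zero_of_corner_mul_eq_zero [Module ℂ A] (halt₁ : ∀ a b : A, a * a * b = a * (a * b))
    (halt₂ : ∀ a b : A, b * a * a = b * (a * a)) {e : A} (heIdem : e * e = e)
    (hcl : ∀ x : A, (∀ r : A, x * r * (1 - e) = 0) → x = 0)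
    {D : A} (hl : e * D = D) (hr : D * e = D)
    (hD : ∀ x : A, e * x = x → x * e = 0 → D * x = 0) : D = 0 := by
  have hee := idem_mul_idem_mul halt₁ heIdem
  have hee' := mul_idem_mul_idem halt₂ heIdem
  have hflex := alternative_flexible halt₁ halt₂
  have hkill : ∀ r, e * r = 0 → D * r = 0 := fun r h0 => by
    have h := alternative_left_polarized halt₁ e D r
    rw [hl, hr, h0, mul_zero, add_zero] at h
    have h2 := congrArg (e * ·) h
    simp only [mul_add, hee] at h2
    have h3 : e * (D * r) = 0 := by simpa using h2
    rw [h3] at h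
    linear_combination (norm := module) (1 / 2 : ℂ) • h
  refine hcl D fun r => ?_
  have hsplit : D * r = D * (e * r) := by
    have h := hkill (r - e * r) (by rw [mul_sub, hee, sub_self])
    rwa [mul_sub, sub_eq_zero] at h
  have h := alternative_right_polarized halt₂ D (e * r) e
  rw [hr, hee, add_left_inj] at h
  have h0 := hD (e * r - e * r * e)
    (by rw [mul_sub, hee, hflex, hee]) (by rw [sub_mul, hee', sub_self])
  rw [mul_sub, sub_eq_zero] at h0
  rw [hsplit, mul_sub, mul_one, h, h0, sub_self]

variable [StarRing A]

/-- The `A₁₂` component of `a • x` for `x ∈ A₁₂`. -/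
theorem peirce_starJordan (halt₁ : ∀ a b : A, a * a * b = a * (a * b))
    (halt₂ : ∀ a b : A, b * a * a = b * (a * a)) {e : A} (heIdem : e * e = e)
    {x : A} (hl : e * x = x) (hr : x * e = 0) (a : A) :
    e * starJordan a x - e * (starJordan a x * e) =
      e * (a * e) * x +
        x * (star a - e * star a - star a * e + e * (star a * e)) := by
  have hee := idem_mul_idem_mul halt₁ heIdem
  have hee' := mul_idem_mul_idem halt₂ heIdem
  have hflex := alternative_flexible halt₁ halt₂
  have hl₁ : ∀ b, e * (b * x) = (e * b + b * e - b) * x := fun b => by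
    have h := alternative_left_polarized halt₁ e b x
    rw [hl] at h
    rw [sub_mul, add_mul, h]; abel
  have hl₂ : ∀ b, b * x * e = (b - b * e) * x := fun b => by
    have h := alternative_right_polarized halt₂ b x e
    rw [hl, hr, mul_zero, zero_add] at h
    rw [sub_mul, eq_sub_iff_add_eq, h]
  have hr₁ : ∀ b, x * b * e = x * (b * e + e * b) := fun b => by
    have h := alternative_right_polarized halt₂ x b e
    rw [hr, zero_mul, add_zero] at h
    rw [mul_add, h]
  have hr₂ : ∀ b, e * (x * b) = x * (b - e * b) := fun b => by
    have h := alternative_left_polarized halt₁ e x b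
    rw [hl, hr, zero_mul, add_zero] at h
    rw [mul_sub, eq_sub_iff_add_eq, ← h]
  simp only [starJordan, mul_add, add_mul, hl₁, hl₂, hr₁, hr₂, hee, hee', sub_mul, mul_sub]
  abel

/-- The diagonal Peirce components of `F = Φ e` in terms of `c = Φ 1`, from the three expressions
of `Φ (2m e)` obtained through `1 • e`, `e • 1` and `e • e`. -/
theorem peirce_values [Module ℂ A] [SMulCommClass ℂ A A] [IsScalarTower ℂ A A]
    (halt₁ : ∀ a b : A, a * a * b = a * (a * b))
    (halt₂ : ∀ a b : A, b * a * a = b * (a * a)) {e : A} (heStar : star e = e) (heIdem : e * e = e)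
    {a b m : ℂ} (ha : ∀ x : A, star (a • x) = a • star x) (hb : ∀ x : A, star (b • x) = b • star x)
    (hmstar : ∀ x : A, star (m • x) = m • star x)
    (hm : m ≠ 0) (hab : a + b + m ≠ 0) (hab' : m + b - a ≠ 0)
    {c F S : A} (hS : S = a • c + b • star c)
    (h₁ : starJordan (starJordan S 1) e + m • (starJordan c e + starJordan 1 F) =
      starJordan (starJordan S e) e + m • (starJordan F e + starJordan e F))
    (h₂ : starJordan (starJordan S e) 1 + m • (starJordan F 1 + starJordan e c) =
      starJordan (starJordan S e) e + m • (starJordan F e + starJordan e F)) :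
    e * (F * e) = e * (c * e) ∧ F - e * F - F * e + e * (F * e) = 0 ∧
      e * c = e * (c * e) ∧ c * e = e * (c * e) := by
  have hee := idem_mul_idem_mul halt₁ heIdem
  have hee' := mul_idem_mul_idem halt₂ heIdem
  have hflex := alternative_flexible halt₁ halt₂
  have cancel : ∀ {k : ℂ} {x : A}, k ≠ 0 → k • x = 0 → x = 0 := fun hk h =>
    (smul_eq_zero_iff_right hk).mp h
  subst hS
  simp only [starJordan, star_add, star_mul, star_star, star_one, heStar, ha, hb, mul_one, one_mul,
    mul_add, add_mul, smul_mul_assoc, mul_smul_comm, hee, hee', hflex] at h₁ h₂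
  have l₁ := congrArg (e * ·) h₁
  have r₁ := congrArg (· * e) h₁
  have lr₁ := congrArg (fun x => e * (x * e)) h₁
  have l₂ := congrArg (e * ·) h₂
  have r₂ := congrArg (· * e) h₂
  have lr₂ := congrArg (fun x => e * (x * e)) h₂
  simp only [mul_add, add_mul, smul_mul_assoc, mul_smul_comm, hee, hee', hflex,
    smul_add] at h₁ l₁ r₁ lr₁ h₂ l₂ r₂ lr₂
  have hF : F - e * F - F * e + e * (F * e) = 0 := by
    refine cancel (mul_ne_zero two_ne_zero hm) ?_
    linear_combination (norm := module) h₁ - l₁ - r₁ + lr₁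
  have hFc : e * (F * e) - e * (c * e) = 0 := by
    refine cancel (mul_ne_zero two_ne_zero hm) ?_
    linear_combination (norm := module) -lr₂
  have h21 : a • (star c * e - e * (star c * e)) + (b + m) • (c * e - e * (c * e)) = 0 := by
    linear_combination (norm := module) r₁ - lr₁
  have h12 : a • (e * star c - e * (star c * e)) + (b + m) • (e * c - e * (c * e)) = 0 := by
    linear_combination (norm := module) l₂ - lr₂
  have h21' := congrArg star h21
  simp only [add_smul, star_add, star_sub, star_mul, star_star, heStar, ha, hb, hmstar, hflex,
    star_zero] at h21'
  have hsum : (e * c - e * (c * e)) + (e * star c - e * (star c * e)) = 0 := by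
    refine cancel hab ?_
    linear_combination (norm := module) h12 + h21'
  have hdiff : (e * c - e * (c * e)) - (e * star c - e * (star c * e)) = 0 := by
    refine cancel hab' ?_
    linear_combination (norm := module) h12 - h21'
  have h12c : e * c - e * (c * e) = 0 := by
    linear_combination (norm := module) (1 / 2 : ℂ) • hsum + (1 / 2 : ℂ) • hdiff
  have h12s : e * star c - e * (star c * e) = 0 := by
    linear_combination (norm := module) (1 / 2 : ℂ) • hsum - (1 / 2 : ℂ) • hdiff
  have h21c := congrArg star h12s
  simp only [star_sub, star_mul, star_star, heStar, hflex, star_zero] at h21c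
  exact ⟨sub_eq_zero.mp hFc, hF, sub_eq_zero.mp h12c, sub_eq_zero.mp h21c⟩

/-- If `Φ` satisfies the two-variable identity `hΦ`, then the `e`-corner of `S + S* + m Φ(1)`
vanishes. -/
theorem corner_eq_zero [Module ℂ A] [SMulCommClass ℂ A A] [IsScalarTower ℂ A A]
    (halt₁ : ∀ a b : A, a * a * b = a * (a * b))
    (halt₂ : ∀ a b : A, b * a * a = b * (a * a)) {e : A} (heStar : star e = e) (heIdem : e * e = e)
    (hcl : ∀ x : A, (∀ r : A, x * r * (1 - e) = 0) → x = 0)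
    {p : ℕ} {S : A} {Φ : A → A}
    (hΦ : ∀ x y : A, Φ ((2 : ℂ) ^ p • starJordan x y) = starJordan (starJordan S x) y +
      (2 : ℂ) ^ p • (starJordan (Φ x) y + starJordan x (Φ y)))
    (hF₁ : e * (Φ e * e) = e * (Φ 1 * e))
    (hF₂ : Φ e - e * Φ e - Φ e * e + e * (Φ e * e) = 0)
    (hG₁ : e * (Φ (1 - e) * e) = 0)
    (hG₂ : Φ (1 - e) - e * Φ (1 - e) - Φ (1 - e) * e =
      Φ 1 - e * Φ 1 - Φ 1 * e + e * (Φ 1 * e)) :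
    e * ((S + star S + (2 : ℂ) ^ p • Φ 1) * e) = 0 := by
  have hee := idem_mul_idem_mul halt₁ heIdem
  have hee' := mul_idem_mul_idem halt₂ heIdem
  have hflex := alternative_flexible halt₁ halt₂
  have hm : (2 : ℂ) ^ p ≠ 0 := pow_ne_zero p two_ne_zero
  have hF₂' := congrArg star hF₂
  have hG₁' := congrArg star hG₁
  have hG₂' := congrArg star hG₂
  simp only [star_add, star_sub, star_mul, star_zero, heStar, hflex] at hF₂' hG₁' hG₂'
  refine eq_zero_of_corner_mul_eq_zero halt₁ halt₂ heIdem hcl (hee _)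
    (by rw [hflex, hee']) fun x hl hr => ?_
  set g : A → A := fun y => e * Φ y - e * (Φ y * e) with hg
  set u : A → A := fun y => e * ((S + star S + (2 : ℂ) ^ p • Φ 1) * e) * y with hu
  set v : A → A := fun y => y * (S + star S - e * (S + star S) - (S + star S) * e +
    e * ((S + star S) * e) + (2 : ℂ) ^ p •
      (star (Φ 1) - e * star (Φ 1) - star (Φ 1) * e + e * (star (Φ 1) * e))) with hv
  have hA : ∀ y, e * y = y → y * e = 0 → g ((2 : ℂ) ^ p • y) = u y + (2 : ℂ) ^ p • g y := by
    intro y hl hr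
    have h := hΦ e y
    have hK := peirce_starJordan halt₁ halt₂ heIdem hl hr
    have h1 := hK (starJordan S e)
    have h2 := hK (Φ e)
    rw [show star (Φ e) - e * star (Φ e) - star (Φ e) * e + e * (star (Φ e) * e) = 0 by
      rw [← hF₂']; abel, hF₁, mul_zero, add_zero] at h2
    have hey : starJordan e y = y := by simp [starJordan, hl, heStar, hr]
    rw [hey] at h
    have h3 : e * starJordan e (Φ y) - e * (starJordan e (Φ y) * e) = g y := by
      simp only [starJordan, heStar, hg, mul_add, add_mul, hee, hee', hflex]; abel
    rw [show e * (starJordan S e * e) = e * ((S + star S) * e) by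
        simp only [starJordan, mul_add, add_mul, hee, hee', hflex],
      show star (starJordan S e) - e * star (starJordan S e) - star (starJordan S e) * e +
        e * (star (starJordan S e) * e) = 0 by
        simp only [starJordan, star_add, star_mul, star_star, heStar, mul_add, add_mul, hee, hee',
          hflex]
        abel, mul_zero, add_zero] at h1
    simp only [hg, h, hu] at h3 ⊢
    simp only [mul_add, add_mul, mul_smul_comm, smul_mul_assoc] at h1 h2 h3 ⊢
    linear_combination (norm := module) h1 + (2 : ℂ) ^ p • h2 + (2 : ℂ) ^ p • h3
  have hB : ∀ y, e * y = y → y * e = 0 → g ((2 : ℂ) ^ p • y) = v y + (2 : ℂ) ^ p • g y := by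
    intro y hl hr
    have h := hΦ (1 - e) y
    have hK := peirce_starJordan halt₁ halt₂ heIdem hl hr
    have h1 := hK (starJordan S (1 - e))
    have h2 := hK (Φ (1 - e))
    rw [show star (Φ (1 - e)) - e * star (Φ (1 - e)) - star (Φ (1 - e)) * e +
      e * (star (Φ (1 - e)) * e) =
        star (Φ 1) - e * star (Φ 1) - star (Φ 1) * e + e * (star (Φ 1) * e) by
      rw [hG₁', add_zero]
      linear_combination (norm := module) hG₂', hG₁, zero_mul, zero_add] at h2
    have hey : starJordan (1 - e) y = y := by simp [starJordan, hl, heStar, hr, sub_mul, mul_sub]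
    rw [hey] at h
    have h3 : e * starJordan (1 - e) (Φ y) - e * (starJordan (1 - e) (Φ y) * e) = g y := by
      simp only [starJordan, star_sub, star_one, heStar, hg, mul_add, add_mul, sub_mul, mul_sub,
        one_mul, mul_one, hee, hee', hflex]
      abel
    rw [show e * (starJordan S (1 - e) * e) = 0 by
        simp only [starJordan, mul_add, add_mul, sub_mul, mul_sub, one_mul, mul_one, hee,
          hee', hflex]
        abel,
      show star (starJordan S (1 - e)) - e * star (starJordan S (1 - e)) -
        star (starJordan S (1 - e)) * e + e * (star (starJordan S (1 - e)) * e) =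
        S + star S - e * (S + star S) - (S + star S) * e + e * ((S + star S) * e) by
        simp only [starJordan, star_add, star_mul, star_sub, star_star, heStar, mul_add,
          add_mul, sub_mul, mul_sub, one_mul, mul_one, hee, hee', hflex]
        abel, zero_mul, zero_add] at h1
    simp only [hg, h, hv] at h3 ⊢
    simp only [mul_add, add_mul, mul_sub, mul_smul_comm, smul_mul_assoc] at h1 h2 h3 ⊢
    linear_combination (norm := module) h1 + (2 : ℂ) ^ p • h2 + (2 : ℂ) ^ p • h3
  have hC : ∀ y, e * y = y → y * e = 0 →
      g ((2 : ℂ) ^ p • (2 : ℂ) • y) = u y + v y + (2 : ℂ) ^ p • (2 : ℂ) • g y := by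
    intro y hl hr
    have h := hΦ 1 y
    have hK := peirce_starJordan halt₁ halt₂ heIdem hl hr
    have h1 := hK (starJordan S 1)
    have h2 := hK (Φ 1)
    have h1y : ∀ z : A, starJordan 1 z = (2 : ℂ) • z := fun z => by
      simp [starJordan, two_smul]
    have hS1 : starJordan S 1 = S + star S := by simp [starJordan]
    have hS1' : star (S + star S) = S + star S := by rw [star_add, star_star, add_comm]
    rw [h1y, h1y, hS1] at h
    rw [hS1, hS1'] at h1
    simp only [hg, h, hu, hv]
    simp only [mul_add, add_mul, mul_sub, mul_smul_comm, smul_mul_assoc] at h1 h2 ⊢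
    linear_combination (norm := module) h1 + (2 : ℂ) ^ p • h2
  have huv : ∀ y, e * y = y → y * e = 0 → u y = v y := fun y hl hr =>
    add_right_cancel ((hA y hl hr).symm.trans (hB y hl hr))
  have hsmul : ∀ (k : ℂ) y, e * y = y → y * e = 0 → e * (k • y) = k • y ∧ k • y * e = 0 :=
    fun k y hl hr => by rw [mul_smul_comm, hl, smul_mul_assoc, hr, smul_zero]; exact ⟨rfl, rfl⟩
  have hdouble : ∀ y, e * y = y → y * e = 0 → g ((2 : ℂ) • y) = (2 : ℂ) • g y := by
    intro y hl hr
    have h := hA ((2 : ℂ) • y) (hsmul 2 y hl hr).1 (hsmul 2 y hl hr).2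
    rw [hC y hl hr, ← huv y hl hr] at h
    have hu2 : u ((2 : ℂ) • y) = (2 : ℂ) • u y := mul_smul_comm _ _ _
    rw [hu2] at h
    refine sub_eq_zero.mp ((smul_eq_zero_iff_right hm).mp ?_)
    linear_combination (norm := module) -h
  have hpow : ∀ k : ℕ, g ((2 : ℂ) ^ k • x) = (2 : ℂ) ^ k • g x := by
    intro k
    induction k with
    | zero => simp
    | succ k ih =>
      have h := hsmul ((2 : ℂ) ^ k) x hl hr
      rw [pow_succ', mul_smul, hdouble _ h.1 h.2, ih, mul_smul]
  have h := hA x hl hr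
  rw [hpow, right_eq_add] at h
  exact h

/-- A map satisfying the two-variable identity `hΦ` kills `1` and sends the idempotent `e` to
`A₁₂ + A₂₁`. -/
theorem peirce_offDiagonal [Module ℂ A] [SMulCommClass ℂ A A] [IsScalarTower ℂ A A]
    (halt₁ : ∀ a b : A, a * a * b = a * (a * b))
    (halt₂ : ∀ a b : A, b * a * a = b * (a * a)) {e : A} (heStar : star e = e) (heIdem : e * e = e)
    (hsp : ∀ x : A, (∀ r : A, x * r * e = 0) → x = 0)
    (hcl : ∀ x : A, (∀ r : A, x * r * (1 - e) = 0) → x = 0)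
    {p a b : ℕ} (hab : a < 2 ^ p + b) {Φ : A → A}
    (hΦ : ∀ x y : A, Φ ((2 : ℂ) ^ p • starJordan x y) =
      starJordan (starJordan ((a : ℂ) • Φ 1 + (b : ℂ) • star (Φ 1)) x) y +
      (2 : ℂ) ^ p • (starJordan (Φ x) y + starJordan x (Φ y))) :
    Φ 1 = 0 ∧ e * (Φ e * e) = 0 ∧ Φ e - e * Φ e - Φ e * e = 0 ∧
      e * (Φ (1 - e) * e) = 0 ∧ Φ (1 - e) - e * Φ (1 - e) - Φ (1 - e) * e = 0 := by
  have hstar : ∀ (k : ℕ) (x : A), star ((k : ℂ) • x) = (k : ℂ) • star x := fun k x => by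
    rw [Nat.cast_smul_eq_nsmul, Nat.cast_smul_eq_nsmul, star_nsmul]
  have hmstar : ∀ x : A, star ((2 : ℂ) ^ p • x) = (2 : ℂ) ^ p • star x := fun x => by
    have h := hstar (2 ^ p) x
    push_cast at h
    exact h
  have hm : (2 : ℂ) ^ p ≠ 0 := pow_ne_zero p two_ne_zero
  have hsum : (a : ℂ) + b + 2 ^ p ≠ 0 := by
    have h : a + b + 2 ^ p ≠ 0 := by positivity
    exact_mod_cast h
  have hsum' : 2 * ((a : ℂ) + b) + 2 ^ p ≠ 0 := by
    have h : 2 * (a + b) + 2 ^ p ≠ 0 := by positivity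
    exact_mod_cast h
  have hdiff : (2 : ℂ) ^ p + b - a ≠ 0 := by
    rw [sub_ne_zero]
    exact_mod_cast hab.ne'
  have values : ∀ {f : A}, star f = f → f * f = f →
      f * (Φ f * f) = f * (Φ 1 * f) ∧ Φ f - f * Φ f - Φ f * f + f * (Φ f * f) = 0 ∧
        f * Φ 1 = f * (Φ 1 * f) ∧ Φ 1 * f = f * (Φ 1 * f) := by
    intro f hf hff
    have h1 : starJordan 1 f = f + f := by simp [starJordan]
    have h2 : starJordan f 1 = f + f := by simp [starJordan, hf]
    have h3 : starJordan f f = f + f := by simp [starJordan, hf, hff]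
    refine peirce_values halt₁ halt₂ hf hff (hstar a) (hstar b) hmstar hm hsum hdiff rfl ?_ ?_
    · rw [← hΦ, ← hΦ, h1, h3]
    · rw [← hΦ, ← hΦ, h2, h3]
  have hfStar : star (1 - e) = 1 - e := by rw [star_sub, star_one, heStar]
  have hfIdem : (1 - e) * (1 - e) = 1 - e := by simp [sub_mul, mul_sub, heIdem]
  have hflex := alternative_flexible halt₁ halt₂
  obtain ⟨hF₁, hF₂, hc₁, hc₂⟩ := values heStar heIdem
  obtain ⟨hG₁, hG₂, -, -⟩ := values hfStar hfIdem
  have hG₀ : e * (Φ (1 - e) * e) = 0 := by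
    simp only [sub_mul, mul_sub, one_mul, mul_one] at hG₂
    rw [← hG₂]; abel
  have hG : Φ (1 - e) - e * Φ (1 - e) - Φ (1 - e) * e =
      Φ 1 - e * Φ 1 - Φ 1 * e + e * (Φ 1 * e) := by
    simp only [sub_mul, mul_sub, one_mul, mul_one, hG₀] at hG₁
    linear_combination (norm := module) hG₁
  have hT₁ := corner_eq_zero halt₁ halt₂ heStar heIdem hcl hΦ hF₁ hF₂ hG₀ hG
  have hT₂ := corner_eq_zero halt₁ halt₂ hfStar hfIdem (by simpa using hsp) hΦ hG₁ hG₂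
    (by
      rw [sub_sub_cancel, ← hF₂]
      simp only [sub_mul, mul_sub, one_mul, mul_one]; abel)
    (by
      rw [sub_sub_cancel]
      simp only [sub_mul, mul_sub, one_mul, mul_one]
      linear_combination (norm := module) hF₁ - hF₂)
  have hc₁' := congrArg star hc₁
  have hc₂' := congrArg star hc₂
  simp only [star_mul, heStar, hflex] at hc₁' hc₂'
  simp only [star_add, star_star, hstar, sub_mul, mul_sub, one_mul, mul_one, mul_add, add_mul,
    mul_smul_comm, smul_mul_assoc] at hT₁ hT₂
  have hT : ((a : ℂ) + b) • (Φ 1 + star (Φ 1)) + (2 : ℂ) ^ p • Φ 1 = 0 := by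
    linear_combination (norm := module) hT₂ - hT₁ + ((a : ℂ) + b + 2 ^ p) • (hc₁ + hc₂) +
      ((a : ℂ) + b) • (hc₁' + hc₂') + (2 : ℂ) • hT₁
  have hT' := congrArg star hT
  simp only [add_smul, smul_add, star_add, star_star, hstar, hmstar, star_zero] at hT'
  have hself : Φ 1 - star (Φ 1) = 0 := by
    refine (smul_eq_zero_iff_right hm).mp ?_
    linear_combination (norm := module) hT - hT'
  have h1 : Φ 1 = 0 := by
    refine (smul_eq_zero_iff_right hsum').mp ?_
    linear_combination (norm := module) hT + ((a : ℂ) + b) • hself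
  rw [h1, zero_mul, mul_zero] at hF₁
  rw [hF₁, add_zero] at hF₂
  rw [h1] at hG
  exact ⟨h1, hF₁, hF₂, hG₀, by simpa using hG⟩

end Alternative

section IteratedProduct

theorem lastTwoFamily_castSucc {A : Type*} [One A] {q : ℕ} (x y : A) :
    (fun i : Fin (q + 1) => lastTwoFamily (q + 2) x y i.castSucc) =
      fun i => if i = Fin.last q then x else 1 := by
  funext i
  have h1 : (i : ℕ) ≠ q + 1 := i.isLt.ne
  simp [lastTwoFamily, Fin.ext_iff, h1]

theorem lastTwoFamily_last {A : Type*} [One A] {q : ℕ} (x y : A) :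
    lastTwoFamily (q + 2) x y (Fin.last _) = y := by
  simp [lastTwoFamily]

variable {A : Type*} [NonAssocRing A] [StarRing A]

theorem starJordan_add_left (x y z : A) :
    starJordan (x + y) z = starJordan x z + starJordan y z := by
  simp only [starJordan, add_mul, mul_add, star_add]; abel

theorem starJordan_nsmul_left (k : ℕ) (x y : A) :
    starJordan (k • x) y = k • starJordan x y := by
  simp only [starJordan, star_nsmul, smul_mul_assoc, mul_smul_comm, smul_add]

theorem starJordan_sum_left {ι : Type*} (s : Finset ι) (g : ι → A) (y : A) :
    starJordan (∑ i ∈ s, g i) y = ∑ i ∈ s, starJordan (g i) y := by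
  simp only [starJordan, star_sum, Finset.sum_mul, Finset.mul_sum, Finset.sum_add_distrib]

theorem starJordan_one_left (y : A) : starJordan 1 y = 2 • y := by
  simp [starJordan, two_smul]

theorem leftStarJordan_append {l l' : List A} (hl : l ≠ []) :
    leftStarJordan (l ++ l') = l'.foldl starJordan (leftStarJordan l) := by
  cases l with
  | nil => exact absurd rfl hl
  | cons a l => simp [leftStarJordan, List.foldl_append]

theorem leftStarJordan_ofFn_succ {q : ℕ} (g : Fin (q + 2) → A) :
    leftStarJordan (List.ofFn g) =
      starJordan (leftStarJordan (List.ofFn fun i : Fin (q + 1) => g i.castSucc))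
        (g (Fin.last _)) := by
  rw [List.ofFn_succ_last, leftStarJordan_append (by simp)]
  rfl

theorem leftStarJordan_ofFn_one (q : ℕ) :
    leftStarJordan (List.ofFn fun _ : Fin (q + 1) => (1 : A)) = 2 ^ q • (1 : A) := by
  induction q with
  | zero => simp [leftStarJordan]
  | succ q ih =>
    rw [leftStarJordan_ofFn_succ, ih, starJordan_nsmul_left, starJordan_one_left, smul_smul,
      pow_succ]

theorem update_castSucc {α : Type*} {q : ℕ} (g : Fin (q + 1) → α) (k : Fin q) (c : α) :
    (fun i : Fin q => Function.update g k.castSucc c i.castSucc) =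
      Function.update (fun i : Fin q => g i.castSucc) k c := by
  funext i
  by_cases h : i = k
  · subst h; simp
  · rw [Function.update_of_ne h,
      Function.update_of_ne fun h' => h (Fin.castSucc_injective q h')]

theorem update_last {α : Type*} {q : ℕ} (g : Fin (q + 1) → α) (c : α) :
    (fun i : Fin q => Function.update g (Fin.last q) c i.castSucc) = fun i => g i.castSucc := by
  funext i
  rw [Function.update_of_ne (Fin.castSucc_lt_last i).ne]

/-- The sum over all slots of a Leibniz expansion, with the last slot split off. -/
theorem sum_leftStarJordan_update {q : ℕ} (g h : Fin (q + 2) → A) :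
    ∑ k, leftStarJordan (List.ofFn (Function.update g k (h k))) =
      starJordan (∑ k : Fin (q + 1), leftStarJordan (List.ofFn
        (Function.update (fun i : Fin (q + 1) => g i.castSucc) k (h k.castSucc))))
        (g (Fin.last _)) +
      starJordan (leftStarJordan (List.ofFn fun i : Fin (q + 1) => g i.castSucc))
        (h (Fin.last _)) := by
  rw [Fin.sum_univ_castSucc, starJordan_sum_left]
  congr 1
  · refine Finset.sum_congr rfl fun k _ => ?_
    rw [leftStarJordan_ofFn_succ, update_castSucc,
      Function.update_of_ne (Fin.castSucc_lt_last k).ne']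
  · rw [leftStarJordan_ofFn_succ, update_last, Function.update_self]

theorem exists_sum_leftStarJordan_update_one (q : ℕ) (c : A) :
    ∃ b : ℕ, ∑ k, leftStarJordan (List.ofFn
      (Function.update (fun _ : Fin (q + 1) => (1 : A)) k c)) = (b + 2 ^ q) • c + b • star c := by
  induction q with
  | zero => exact ⟨0, by simp [leftStarJordan]⟩
  | succ q ih =>
    obtain ⟨b, hb⟩ := ih
    refine ⟨2 * b + 2 ^ q, ?_⟩
    rw [sum_leftStarJordan_update (fun _ => 1) (fun _ => c), hb, leftStarJordan_ofFn_one,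
      starJordan_nsmul_left, starJordan_one_left]
    simp only [starJordan, star_add, star_nsmul, star_star, mul_one, one_mul]
    module

/-- The `n`-fold identity in its last two slots reduces to a two-variable identity. -/
theorem exists_two_variable_identity {p : ℕ} {Φ : A → A}
    (hΦ : ∀ x y : A,
      Φ (leftStarJordan (List.ofFn (lastTwoFamily (p + 2) x y))) =
        ∑ k : Fin (p + 2), leftStarJordan (List.ofFn (Function.update (lastTwoFamily (p + 2) x y) k
          (Φ (lastTwoFamily (p + 2) x y k))))) :
    ∃ a b : ℕ, a < 2 ^ p + b ∧ ∀ x y : A, Φ (2 ^ p • starJordan x y) =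
      starJordan (starJordan (a • Φ 1 + b • star (Φ 1)) x) y +
        2 ^ p • (starJordan (Φ x) y + starJordan x (Φ y)) := by
  cases p with
  | zero =>
    refine ⟨0, 0, by simp, fun x y => ?_⟩
    have h := hΦ x y
    simp [Fin.sum_univ_two, leftStarJordan, lastTwoFamily, Function.update] at h
    simpa [starJordan] using h
  | succ q =>
    obtain ⟨b, hb⟩ := exists_sum_leftStarJordan_update_one q (Φ 1)
    refine ⟨b + 2 ^ q, b, ?_, fun x y => ?_⟩
    · have := Nat.pow_lt_pow_right (a := 2) one_lt_two (Nat.lt_succ_self q)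
      omega
    · have h := hΦ x y
      have hne : ∀ i : Fin (q + 1), i.castSucc ≠ Fin.last (q + 1) :=
        fun i => (Fin.castSucc_lt_last i).ne
      have hcast : ∀ i : Fin (q + 2), lastTwoFamily (q + 1 + 2) x y i.castSucc =
          if i = Fin.last (q + 1) then x else 1 := congrFun (lastTwoFamily_castSucc x y)
      rw [sum_leftStarJordan_update _ fun k => Φ (lastTwoFamily (q + 1 + 2) x y k),
        leftStarJordan_ofFn_succ] at h
      simp only [lastTwoFamily_last, hcast] at h
      rw [sum_leftStarJordan_update _ fun k => Φ (if k = Fin.last (q + 1) then x else 1),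
        leftStarJordan_ofFn_succ] at h
      simp only [hne, if_true, if_false, hb, leftStarJordan_ofFn_one, starJordan_nsmul_left,
        starJordan_one_left, starJordan_add_left] at h
      simp only [smul_smul, ← pow_succ, ← starJordan_nsmul_left] at h ⊢
      rw [h]
      simp only [starJordan_nsmul_left, starJordan_add_left, smul_add, add_assoc]

end IteratedProduct

theorem stmt_12 {A : Type*} [NonAssocRing A] [Module ℂ A]
    [SMulCommClass ℂ A A] [IsScalarTower ℂ A A] [StarRing A]
    (halt₁ : ∀ a b : A, a * a * b = a * (a * b))
    (halt₂ : ∀ a b : A, b * a * a = b * (a * a))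
    (e : A) (heStar : star e = e) (heIdem : e * e = e) (he0 : e ≠ 0) (he1 : e ≠ 1)
    (hsp : ∀ x : A, (∀ r : A, x * r * e = 0) → x = 0)
    (hcl : ∀ x : A, (∀ r : A, x * r * (1 - e) = 0) → x = 0)
    (n : ℕ) (hn : 2 ≤ n) (Φ : A → A)
    (hΦ : ∀ x y : A,
      Φ (leftStarJordan (List.ofFn (lastTwoFamily n x y))) =
        ∑ k : Fin n, leftStarJordan (List.ofFn
          (Function.update (lastTwoFamily n x y) k (Φ (lastTwoFamily n x y k))))) :
    (∀ i : Fin 2, Φ (peirceIdem e i) =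
        e * (Φ (peirceIdem e i) * (1 - e)) + (1 - e) * (Φ (peirceIdem e i) * e)) ∧
      Φ 1 = 0 := by
  obtain ⟨p, rfl⟩ : ∃ p, n = p + 2 := ⟨n - 2, by omega⟩
  obtain ⟨a, b, hab, h⟩ := exists_two_variable_identity hΦ
  obtain ⟨h1, hF₁, hF₂, hG₁, hG₂⟩ := peirce_offDiagonal (p := p) halt₁ halt₂ heStar heIdem hsp hcl
    hab (Φ := Φ) fun x y => by
      have h' := h x y
      simp only [← Nat.cast_smul_eq_nsmul ℂ] at h'
      push_cast at h'
      exact h'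
  have key : ∀ x : A, e * (x * e) = 0 → x - e * x - x * e = 0 →
      x = e * (x * (1 - e)) + (1 - e) * (x * e) := fun x hx₁ hx₂ => by
    rw [mul_sub, mul_one, mul_sub, sub_mul, one_mul, hx₁, sub_zero, sub_zero, ← sub_eq_zero,
      ← hx₂]
    abel
  refine ⟨fun i => ?_, h1⟩
  fin_cases i
  · exact key _ hF₁ hF₂
  · exact key _ hG₁ hG₂
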